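/- Let 𝒦 be a class of closed transformation monoids, let 𝒢 = {G(M') : M' ∈ 𝒦} be the class of groups of invertible elements of members of 𝒦, and assume that the closure (in the full function monoid) of every member of 𝒢 belongs to 𝒦. Let M ⊆ A → A be a closed transformation monoid whose group G of invertible elements is dense in M and has automatic homeomorphicity with respect to 𝒢. Suppose further: for every set B of the same cardinality as A, all transformation monoids M₁ ⊆ M₂ ⊆ B → B with M₁, M₂ ∈ 𝒦, and all monoid isomorphisms φ₁: M → M₁ and φ₂: M → M₂, if φ₁ and φ₂ agree on G then M₁ = M₂ and φ₁ = φ₂. Then for every set B of the same cardinality as A, every M' ∈ 𝒦 on B and every monoid isomorphism θ: M → M', the image θ(G) is dense in M' and θ is a uniform homeomorphism. -/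

import Mathlib

open Set Function

universe u

/-- The uniformity of pointwise convergence on `I → X` arising from the
discrete uniformity on `X`. -/
noncomputable def funUnif (I X : Type*) : UniformSpace (I → X) :=
  @Pi.uniformSpace I (fun _ => X) (fun _ => ⊥)

/-- The topology of pointwise convergence on `I → X` (over discrete `X`). -/
noncomputable def funTop (I X : Type*) : TopologicalSpace (I → X) :=
  (funUnif I X).toTopologicalSpace

/-- Topological closure w.r.t. the topology of pointwise convergence. -/
def fClosure {I X : Type*} (S : Set (I → X)) : Set (I → X) :=
  @closure _ (funTop I X) S

/-- Closedness w.r.t. the topology of pointwise convergence. -/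
def fIsClosed {I X : Type*} (S : Set (I → X)) : Prop :=
  @IsClosed _ (funTop I X) S

/-- Continuity on a set of functions w.r.t. pointwise convergence topologies. -/
def fContinuousOn {I X J Y : Type*} (ξ : (I → X) → (J → Y)) (S : Set (I → X)) : Prop :=
  @ContinuousOn _ _ (funTop I X) (funTop J Y) ξ S

/-- Uniform continuity on a set of functions w.r.t. pointwise uniformities. -/
def fUniformContinuousOn {I X J Y : Type*} (ξ : (I → X) → (J → Y)) (S : Set (I → X)) : Prop :=
  @UniformContinuousOn _ _ (funUnif I X) (funUnif J Y) ξ S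

/-- A transformation monoid on `A`: a set of self-maps containing the identity
and closed under composition. -/
def IsTransMonoid {A : Type*} (M : Set (A → A)) : Prop :=
  id ∈ M ∧ ∀ f ∈ M, ∀ g ∈ M, f ∘ g ∈ M

/-- The set of invertible elements of a transformation monoid `M`. -/
def invertibles {A : Type*} (M : Set (A → A)) : Set (A → A) :=
  {g | g ∈ M ∧ ∃ f ∈ M, f ∘ g = id ∧ g ∘ f = id}

/-- A monoid homomorphism from `M` to `M'`, given as a (total) map on functions. -/
def MonHomOn {A B : Type*} (M : Set (A → A)) (M' : Set (B → B))
    (ξ : (A → A) → (B → B)) : Prop :=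
  Set.MapsTo ξ M M' ∧ ξ id = id ∧ ∀ f ∈ M, ∀ g ∈ M, ξ (f ∘ g) = ξ f ∘ ξ g

/-- A monoid isomorphism between `M` and `M'`, given by a pair of mutually
inverse monoid homomorphisms. -/
def MonIsoOn {A B : Type*} (M : Set (A → A)) (M' : Set (B → B))
    (ξ : (A → A) → (B → B)) (ξ' : (B → B) → (A → A)) : Prop :=
  MonHomOn M M' ξ ∧ MonHomOn M' M ξ' ∧
    (∀ f ∈ M, ξ' (ξ f) = f) ∧ (∀ h ∈ M', ξ (ξ' h) = h)

theorem exists_finite_eqOn_of_mem_nhds {I X : Type*} {f : I → X} {U : Set (I → X)}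
    (hU : U ∈ @nhds _ (funTop I X) f) :
    ∃ F : Set I, F.Finite ∧ ∀ g : I → X, Set.EqOn g f F → g ∈ U := by
  let : UniformSpace X := ⊥
  change U ∈ nhds f at hU
  rw [nhds_pi, Filter.mem_pi] at hU
  obtain ⟨F, hF, t, ht, htU⟩ := hU
  exact ⟨F, hF, fun g hg => htU fun i hi => by rw [hg hi]; exact mem_of_mem_nhds (ht i)⟩

theorem setOf_eqOn_mem_nhds {I X : Type*} (f : I → X) {F : Set I} (hF : F.Finite) :
    {g | Set.EqOn g f F} ∈ @nhds _ (funTop I X) f := by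
  let : UniformSpace X := ⊥
  have : DiscreteTopology X := ⟨rfl⟩
  change _ ∈ nhds f
  rw [nhds_pi]
  refine Filter.mem_of_superset
    (Filter.pi_mem_pi hF (s := fun i => {f i}) fun i _ => mem_nhds_discrete.2 rfl) ?_
  exact fun g hg i hi => hg i hi

theorem mem_fClosure_iff {I X : Type*} {S : Set (I → X)} {f : I → X} :
    f ∈ fClosure S ↔ ∀ F : Set I, F.Finite → ∃ g ∈ S, Set.EqOn g f F := by
  let := funTop I X
  change f ∈ closure S ↔ _
  rw [mem_closure_iff_nhds]
  constructor
  · intro h F hF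
    obtain ⟨g, hg, hgS⟩ := h _ (setOf_eqOn_mem_nhds f hF)
    exact ⟨g, hgS, hg⟩
  · intro h U hU
    obtain ⟨F, hF, hFU⟩ := exists_finite_eqOn_of_mem_nhds hU
    obtain ⟨g, hgS, hg⟩ := h F hF
    exact ⟨g, hFU g hg, hgS⟩

theorem subset_fClosure {I X : Type*} (S : Set (I → X)) : S ⊆ fClosure S :=
  fun f hf => mem_fClosure_iff.2 fun _ _ => ⟨f, hf, fun _ _ => rfl⟩

theorem fClosure_subset_of_subset {I X : Type*} {S T : Set (I → X)} (hST : S ⊆ T)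
    (hT : fIsClosed T) : fClosure S ⊆ T :=
  @closure_minimal _ (funTop I X) _ _ hST hT

theorem exists_finite_of_fContinuousOn {I X J Y : Type*} {ξ : (I → X) → (J → Y)}
    {S : Set (I → X)} (h : fContinuousOn ξ S) {f : I → X} (hf : f ∈ S) (j : J) :
    ∃ F : Set I, F.Finite ∧ ∀ g ∈ S, Set.EqOn g f F → ξ g j = ξ f j := by
  let := funTop I X
  have hc := h f hf (setOf_eqOn_mem_nhds (ξ f) (Set.finite_singleton j))
  obtain ⟨U, hU, hUS⟩ := mem_nhdsWithin_iff_exists_mem_nhds_inter.1 hc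
  obtain ⟨F, hF, hFU⟩ := exists_finite_eqOn_of_mem_nhds hU
  exact ⟨F, hF, fun g hg hgf => hUS ⟨hFU g hgf, hg⟩ rfl⟩

theorem fUniformContinuousOn_of_forall_exists {I X J Y : Type*} {ξ : (I → X) → (J → Y)}
    {S : Set (I → X)}
    (h : ∀ j, ∃ F : Set I, F.Finite ∧ ∀ f ∈ S, ∀ g ∈ S, Set.EqOn f g F → ξ f j = ξ g j) :
    fUniformContinuousOn ξ S := by
  let : UniformSpace X := ⊥
  let : UniformSpace Y := ⊥
  change UniformContinuousOn ξ S
  unfold UniformContinuousOn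
  rw [show uniformity (J → Y) = _ from Pi.uniformity (fun _ : J => Y), Filter.tendsto_iInf]
  intro j
  rw [Filter.tendsto_comap_iff]
  obtain ⟨F, hF, hFS⟩ := h j
  refine Filter.Tendsto.mono_right (y := Filter.principal SetRel.id) ?_ (by rfl)
  rw [Filter.tendsto_principal, Filter.eventually_inf_principal]
  have hev : ∀ i, ∀ᶠ p : (I → X) × (I → X) in uniformity (I → X), p.1 i = p.2 i := by
    intro i
    have hu := (Pi.uniformContinuous_proj (fun _ : I => X) i)
    exact hu (show (SetRel.id : SetRel X X) ∈ uniformity X from Filter.mem_principal_self _)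
  filter_upwards [(Filter.eventually_all_finite hF).2 fun i _ => hev i] with p hp hpS
  exact hFS p.1 hpS.1 p.2 hpS.2 hp

/-- `e` is obtained on the closure of `S` by continuous extension of `ξ` with modulus `F`. -/
def IsExtensionWithModulus {I X J Y : Type*} (S : Set (I → X)) (ξ e : (I → X) → (J → Y))
    (F : J → Set I) : Prop :=
  (∀ j, (F j).Finite) ∧
    ∀ f ∈ fClosure S, ∀ j, ∀ g ∈ S, Set.EqOn g f (F j) → e f j = ξ g j

theorem exists_isExtensionWithModulus {I X J Y : Type*} {S : Set (I → X)}
    {ξ : (I → X) → (J → Y)}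
    (h : ∀ j, ∃ F : Set I, F.Finite ∧ ∀ f ∈ S, ∀ g ∈ S, Set.EqOn f g F → ξ f j = ξ g j) :
    ∃ e F, IsExtensionWithModulus S ξ e F := by
  classical
  choose F hF hFS using h
  refine ⟨fun f j => if hf : f ∈ fClosure S then
    ξ (mem_fClosure_iff.1 hf (F j) (hF j)).choose j else ξ f j, F, hF, ?_⟩
  intro f hf j g hg hgf
  simp only [dif_pos hf]
  obtain ⟨hk, hkf⟩ := (mem_fClosure_iff.1 hf (F j) (hF j)).choose_spec
  exact hFS j _ hk g hg (hkf.trans hgf.symm)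

namespace IsExtensionWithModulus

variable {I X J Y : Type*} {S : Set (I → X)} {ξ e : (I → X) → (J → Y)} {F : J → Set I}

theorem apply_eq (h : IsExtensionWithModulus S ξ e F) {g : I → X} (hg : g ∈ S) :
    e g = ξ g :=
  funext fun j => h.2 g (subset_fClosure S hg) j g hg fun _ _ => rfl

theorem exists_eqOn (h : IsExtensionWithModulus S ξ e F) {f : I → X} (hf : f ∈ fClosure S)
    {E : Set J} (hE : E.Finite) {D : Set I} (hD : D.Finite) :
    ∃ g ∈ S, Set.EqOn g f D ∧ Set.EqOn (ξ g) (e f) E := by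
  obtain ⟨g, hg, hgf⟩ := mem_fClosure_iff.1 hf (D ∪ ⋃ j ∈ E, F j)
    (hD.union (hE.biUnion fun j _ => h.1 j))
  refine ⟨g, hg, hgf.mono Set.subset_union_left, fun j hj => ?_⟩
  exact (h.2 f hf j g hg (hgf.mono fun i hi => Or.inr (Set.mem_biUnion hj hi))).symm

theorem mapsTo_fClosure (h : IsExtensionWithModulus S ξ e F) {T : Set (J → Y)}
    (hξ : Set.MapsTo ξ S T) : Set.MapsTo e (fClosure S) (fClosure T) := by
  intro f hf
  refine mem_fClosure_iff.2 fun E hE => ?_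
  obtain ⟨g, hg, -, hge⟩ := h.exists_eqOn hf hE Set.finite_empty
  exact ⟨ξ g, hξ hg, hge⟩

theorem fUniformContinuousOn (h : IsExtensionWithModulus S ξ e F) :
    fUniformContinuousOn e (fClosure S) := by
  refine fUniformContinuousOn_of_forall_exists fun j => ⟨F j, h.1 j, fun f hf k hk hfk => ?_⟩
  obtain ⟨g, hg, hgf⟩ := mem_fClosure_iff.1 hf (F j) (h.1 j)
  rw [h.2 f hf j g hg hgf, h.2 k hk j g hg (hgf.trans hfk)]

theorem leftInverse {ξ' e' : (J → Y) → (I → X)} {F' : I → Set J} {T : Set (J → Y)}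
    (h : IsExtensionWithModulus S ξ e F) (h' : IsExtensionWithModulus T ξ' e' F')
    (hξ : Set.MapsTo ξ S T) (hinv : ∀ g ∈ S, ξ' (ξ g) = g) {f : I → X}
    (hf : f ∈ fClosure S) : e' (e f) = f := by
  funext i
  obtain ⟨g, hg, hgf, hge⟩ := h.exists_eqOn hf (h'.1 i) (Set.finite_singleton i)
  rw [h'.2 (e f) (h.mapsTo_fClosure hξ hf) i (ξ g) (hξ hg) hge, hinv g hg]
  exact hgf rfl

end IsExtensionWithModulus

theorem comp_mem_fClosure {A : Type*} {S : Set (A → A)} (hS : IsTransMonoid S)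
    {f h : A → A} (hf : f ∈ fClosure S) (hh : h ∈ fClosure S) : f ∘ h ∈ fClosure S := by
  refine mem_fClosure_iff.2 fun F hF => ?_
  obtain ⟨k, hk, hkh⟩ := mem_fClosure_iff.1 hh F hF
  obtain ⟨g, hg, hgf⟩ := mem_fClosure_iff.1 hf (h '' F) (hF.image h)
  refine ⟨g ∘ k, hS.2 g hg k hk, fun x hx => ?_⟩
  simp only [Function.comp_apply, hkh hx, hgf (Set.mem_image_of_mem h hx)]

theorem IsExtensionWithModulus.monHomOn {A B : Type*} {S : Set (A → A)} {T : Set (B → B)}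
    {ξ e : (A → A) → (B → B)} {F : B → Set A} (h : IsExtensionWithModulus S ξ e F)
    (hS : IsTransMonoid S) (hξ : MonHomOn S T ξ) : MonHomOn (fClosure S) (fClosure T) e := by
  refine ⟨h.mapsTo_fClosure hξ.1, (h.apply_eq hS.1).trans hξ.2.1, fun f hf l hl => ?_⟩
  funext b
  obtain ⟨k, hk, hkl, hke⟩ := h.exists_eqOn hl (Set.finite_singleton b) (h.1 b)
  obtain ⟨g, hg, hgf, hge⟩ := h.exists_eqOn hf (Set.finite_singleton (e l b))
    ((h.1 b).image l)
  have hcomp : Set.EqOn (g ∘ k) (f ∘ l) (F b) := fun x hx => by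
    simp only [Function.comp_apply, hkl hx, hgf (Set.mem_image_of_mem l hx)]
  rw [h.2 _ (comp_mem_fClosure hS hf hl) b _ (hS.2 g hg k hk) hcomp, hξ.2.2 g hg k hk]
  simp only [Function.comp_apply]
  rw [hke rfl, hge rfl]

theorem isTransMonoid_invertibles {A : Type*} {M : Set (A → A)} (hM : IsTransMonoid M) :
    IsTransMonoid (invertibles M) := by
  refine ⟨⟨hM.1, id, hM.1, rfl, rfl⟩, ?_⟩
  rintro f ⟨hf, f', hf', h1, h2⟩ g ⟨hg, g', hg', h3, h4⟩
  refine ⟨hM.2 f hf g hg, g' ∘ f', hM.2 g' hg' f' hf', ?_, ?_⟩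
  · rw [Function.comp_assoc, ← Function.comp_assoc f', h1, Function.id_comp, h3]
  · rw [Function.comp_assoc, ← Function.comp_assoc g, h4, Function.id_comp, h2]

theorem MonHomOn.invertibles {A B : Type*} {M : Set (A → A)} {M' : Set (B → B)}
    {ξ : (A → A) → (B → B)} (h : MonHomOn M M' ξ) :
    MonHomOn (invertibles M) (invertibles M') ξ := by
  refine ⟨?_, h.2.1, fun f hf g hg => h.2.2 f hf.1 g hg.1⟩
  rintro g ⟨hg, f, hf, h1, h2⟩
  refine ⟨h.1 hg, ξ f, h.1 hf, ?_, ?_⟩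
  · rw [← h.2.2 f hf g hg, h1, h.2.1]
  · rw [← h.2.2 g hg f hf, h2, h.2.1]

theorem MonIsoOn.invertibles {A B : Type*} {M : Set (A → A)} {M' : Set (B → B)}
    {ξ : (A → A) → (B → B)} {ξ' : (B → B) → (A → A)} (h : MonIsoOn M M' ξ ξ') :
    MonIsoOn (invertibles M) (invertibles M') ξ ξ' :=
  ⟨h.1.invertibles, h.2.1.invertibles, fun f hf => h.2.2.1 f hf.1,
    fun f hf => h.2.2.2 f hf.1⟩

/-- A continuous homomorphism on a permutation group is uniformly continuous. -/
theorem exists_finite_modulus_of_fContinuousOn_invertibles {A B : Type*} {M : Set (A → A)}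
    {N : Set (B → B)} (hM : IsTransMonoid M) {ξ : (A → A) → (B → B)}
    (hξ : MonHomOn (invertibles M) N ξ) (hc : fContinuousOn ξ (invertibles M)) (b : B) :
    ∃ F : Set A, F.Finite ∧ ∀ f ∈ invertibles M, ∀ g ∈ invertibles M,
      Set.EqOn f g F → ξ f b = ξ g b := by
  have hG := isTransMonoid_invertibles hM
  obtain ⟨F, hF, hFS⟩ := exists_finite_of_fContinuousOn hc hG.1 b
  refine ⟨F, hF, fun f hf g hg hfg => ?_⟩
  obtain ⟨g', hg'M, h1, h2⟩ := hg.2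
  have hg' : g' ∈ invertibles M := ⟨hg'M, g, hg.1, h2, h1⟩
  have hfix : ξ (g' ∘ f) b = b := by
    rw [hFS (g' ∘ f) (hG.2 g' hg' f hf) fun x hx => ?_, hξ.2.1, id]
    rw [Function.comp_apply, hfg hx]
    exact congrFun h1 x
  have hfg' : g ∘ (g' ∘ f) = f := by rw [← Function.comp_assoc, h2, Function.id_comp]
  rw [← hfg', hξ.2.2 g hg _ (hG.2 g' hg' f hf), Function.comp_apply, hfix]

/-- Under the group-extension property, every monoid
isomorphism from `M` onto a member of `𝒦` maps the invertibles onto a dense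
set and is a uniform homeomorphism. -/
theorem group_extension_implies_uniform_homeomorphism
    {A : Type u}
    (𝒦 : ∀ B : Type u, Set (Set (B → B)))
    (h𝒦 : ∀ (B : Type u), ∀ M' ∈ 𝒦 B, IsTransMonoid M' ∧ fIsClosed M')
    (h𝒦cl : ∀ (B : Type u), ∀ M' ∈ 𝒦 B, fClosure (invertibles M') ∈ 𝒦 B)
    (M : Set (A → A)) (hM : IsTransMonoid M) (hMclosed : fIsClosed M)
    (hdense : M ⊆ fClosure (invertibles M))
    (hGah : ∀ (B : Type u), Nonempty (A ≃ B) → ∀ M'' ∈ 𝒦 B,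
      ∀ (ξ : (A → A) → (B → B)) (ξ' : (B → B) → (A → A)),
        MonIsoOn (invertibles M) (invertibles M'') ξ ξ' →
        fContinuousOn ξ (invertibles M) ∧ fContinuousOn ξ' (invertibles M''))
    (hext : ∀ (B : Type u), Nonempty (A ≃ B) → ∀ M₁ M₂ : Set (B → B),
      M₁ ∈ 𝒦 B → M₂ ∈ 𝒦 B → M₁ ⊆ M₂ →
      ∀ (φ₁ : (A → A) → (B → B)) (φ₁' : (B → B) → (A → A))
        (φ₂ : (A → A) → (B → B)) (φ₂' : (B → B) → (A → A)),
        MonIsoOn M M₁ φ₁ φ₁' → MonIsoOn M M₂ φ₂ φ₂' →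
        (∀ g ∈ invertibles M, φ₁ g = φ₂ g) →
        M₁ = M₂ ∧ ∀ f ∈ M, φ₁ f = φ₂ f) :
    ∀ (B : Type u), Nonempty (A ≃ B) → ∀ M' ∈ 𝒦 B,
      ∀ (θ : (A → A) → (B → B)) (θ' : (B → B) → (A → A)),
        MonIsoOn M M' θ θ' →
        M' ⊆ fClosure (θ '' invertibles M) ∧
        fUniformContinuousOn θ M ∧ fUniformContinuousOn θ' M' := by
  intro B hAB M' hM' θ θ' hθ
  obtain ⟨hM'mon, hM'closed⟩ := h𝒦 B M' hM'
  have hθG := hθ.invertibles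
  obtain ⟨hc, hc'⟩ := hGah B hAB M' hM' θ θ' hθG
  obtain ⟨e, F, he⟩ := exists_isExtensionWithModulus
    (exists_finite_modulus_of_fContinuousOn_invertibles hM hθG.1 hc)
  obtain ⟨e', F', he'⟩ := exists_isExtensionWithModulus
    (exists_finite_modulus_of_fContinuousOn_invertibles hM'mon hθG.2.1 hc')
  have hMcl : fClosure (invertibles M) = M :=
    (fClosure_subset_of_subset (fun _ hg => hg.1) hMclosed).antisymm hdense
  have hiso : MonIsoOn M (fClosure (invertibles M')) e e' := by
    have hiso' : MonIsoOn (fClosure (invertibles M)) (fClosure (invertibles M')) e e' :=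
      ⟨he.monHomOn (isTransMonoid_invertibles hM) hθG.1,
        he'.monHomOn (isTransMonoid_invertibles hM'mon) hθG.2.1,
        fun _ hf => he.leftInverse he' hθG.1.1 hθG.2.2.1 hf,
        fun _ hf => he'.leftInverse he hθG.2.1.1 hθG.2.2.2 hf⟩
    rwa [hMcl] at hiso'
  obtain ⟨hcl, heq⟩ := hext B hAB _ M' (h𝒦cl B M' hM') hM'
    (fClosure_subset_of_subset (fun _ hg => hg.1) hM'closed) e e' θ θ' hiso hθ
    fun g hg => he.apply_eq hg
  have heq' : ∀ h ∈ M', e' h = θ' h := fun h hh => by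
    have hθ'h := hθ.2.1.1 hh
    rw [← hiso.2.2.1 (θ' h) hθ'h, heq _ hθ'h, hθ.2.2.2 h hh]
  have himage : θ '' invertibles M = invertibles M' :=
    hθG.1.1.image_subset.antisymm fun h hh => ⟨θ' h, hθG.2.1.1 hh, hθG.2.2.2 h hh⟩
  have hu := he.fUniformContinuousOn
  have hu' := he'.fUniformContinuousOn
  rw [hMcl] at hu
  rw [hcl] at hu'
  refine ⟨by rw [himage, hcl], ?_, ?_⟩
  · exact (@UniformContinuousOn.congr _ _ (funUnif A A) (funUnif B B) _ _ _ hu heq)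
  · exact (@UniformContinuousOn.congr _ _ (funUnif B B) (funUnif A A) _ _ _ hu' heq')
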